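/- The Pauli twirl leaves the diagonal Pauli-transfer-matrix entries of a linear map unchanged: for every linear map Λ on the space of 2^n × 2^n complex matrices and every g : Fin n → Fin 4, Tr(P_g · T(Λ)(P_g)) = Tr(P_g · Λ(P_g)). (Consequently linear figures of merit such as the average gate fidelity are unaffected by twirling.) -/

import Mathlib

open Matrix

/-- The single-qubit Pauli matrices σ₀ = I, σ₁ = X, σ₂ = Y, σ₃ = Z. -/
noncomputable def pauli : Fin 4 → Matrix (Fin 2) (Fin 2) ℂ
  | 0 => !![1, 0; 0, 1]
  | 1 => !![0, 1; 1, 0]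
  | 2 => !![0, -Complex.I; Complex.I, 0]
  | 3 => !![1, 0; 0, -1]

/-- The n-qubit Pauli word `P_f = ⊗ᵢ σ_{f i}`, as a matrix indexed by `Fin n → Fin 2`. -/
noncomputable def pauliWord (n : ℕ) (f : Fin n → Fin 4) :
    Matrix (Fin n → Fin 2) (Fin n → Fin 2) ℂ :=
  Matrix.of fun x y => ∏ i, pauli (f i) (x i) (y i)

/-- The Pauli twirl of a linear map Λ on n-qubit matrices:
`T(Λ)(ρ) = 4^{-n} ∑_f P_f ⬝ Λ(P_f ⬝ ρ ⬝ P_f) ⬝ P_f`. -/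
noncomputable def pauliTwirl {n : ℕ}
    (Λ : Matrix (Fin n → Fin 2) (Fin n → Fin 2) ℂ →ₗ[ℂ]
         Matrix (Fin n → Fin 2) (Fin n → Fin 2) ℂ)
    (ρ : Matrix (Fin n → Fin 2) (Fin n → Fin 2) ℂ) :
    Matrix (Fin n → Fin 2) (Fin n → Fin 2) ℂ :=
  ((4 : ℂ) ^ n)⁻¹ • ∑ f : Fin n → Fin 4,
    pauliWord n f * Λ (pauliWord n f * ρ * pauliWord n f) * pauliWord n f

/-- Conjugating a single-qubit Pauli matrix by another one changes it at most by a sign. -/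
theorem exists_sign_pauli_conj (a b : Fin 4) :
    ∃ s : ℂ, s * s = 1 ∧ pauli a * pauli b * pauli a = s • pauli b := by
  refine ⟨if a = 0 ∨ b = 0 ∨ a = b then 1 else -1, by split_ifs <;> norm_num, ?_⟩
  fin_cases a <;> fin_cases b <;> ext i j <;> fin_cases i <;> fin_cases j <;>
    simp [pauli, Matrix.mul_apply, Fin.sum_univ_two]

/-- Multiplication of matrices in Kronecker product form is factorwise. -/
theorem of_prod_mul_of_prod {ι κ R : Type*} [Fintype ι] [DecidableEq ι] [Fintype κ]
    [CommSemiring R] (A B : ι → Matrix κ κ R) :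
    (Matrix.of fun x y : ι → κ => ∏ i, A i (x i) (y i)) *
        (Matrix.of fun x y : ι → κ => ∏ i, B i (x i) (y i)) =
      Matrix.of fun x y : ι → κ => ∏ i, (A i * B i) (x i) (y i) := by
  ext x y
  simp only [Matrix.mul_apply, Matrix.of_apply, ← Finset.prod_mul_distrib]
  rw [Finset.prod_univ_sum, Fintype.piFinset_univ]

/-- Conjugating a Pauli word by another one changes it at most by a sign. -/
theorem exists_sign_pauliWord_conj {n : ℕ} (f g : Fin n → Fin 4) :
    ∃ s : ℂ, s * s = 1 ∧
      pauliWord n f * pauliWord n g * pauliWord n f = s • pauliWord n g := by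
  choose s hs hconj using fun i => exists_sign_pauli_conj (f i) (g i)
  refine ⟨∏ i, s i, by simp [← Finset.prod_mul_distrib, hs], ?_⟩
  unfold pauliWord
  rw [of_prod_mul_of_prod, of_prod_mul_of_prod (fun i => pauli (f i) * pauli (g i))]
  ext x y
  simp [hconj, Finset.prod_mul_distrib]

/-- Each summand of the twirl has the same diagonal Pauli-transfer-matrix entries as `Λ`. -/
theorem trace_pauliWord_mul_conj {n : ℕ}
    (Λ : Matrix (Fin n → Fin 2) (Fin n → Fin 2) ℂ →ₗ[ℂ]
         Matrix (Fin n → Fin 2) (Fin n → Fin 2) ℂ)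
    (f g : Fin n → Fin 4) :
    Matrix.trace (pauliWord n g *
        (pauliWord n f * Λ (pauliWord n f * pauliWord n g * pauliWord n f) * pauliWord n f)) =
      Matrix.trace (pauliWord n g * Λ (pauliWord n g)) := by
  obtain ⟨s, hs, hconj⟩ := exists_sign_pauliWord_conj f g
  rw [← Matrix.mul_assoc, Matrix.trace_mul_comm, ← Matrix.mul_assoc, ← Matrix.mul_assoc, hconj]
  simp [← mul_assoc, hs]

/-- The Pauli twirl leaves the diagonal Pauli-transfer-matrix entries unchanged:
`Tr(P_g ⬝ T(Λ)(P_g)) = Tr(P_g ⬝ Λ(P_g))`. -/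
theorem pauliTwirl_diagonal_invariant (n : ℕ)
    (Λ : Matrix (Fin n → Fin 2) (Fin n → Fin 2) ℂ →ₗ[ℂ]
         Matrix (Fin n → Fin 2) (Fin n → Fin 2) ℂ)
    (g : Fin n → Fin 4) :
    Matrix.trace (pauliWord n g * pauliTwirl Λ (pauliWord n g)) =
      Matrix.trace (pauliWord n g * Λ (pauliWord n g)) := by
  simp only [pauliTwirl, Matrix.mul_smul, Matrix.trace_smul, Finset.mul_sum, Matrix.trace_sum,
    trace_pauliWord_mul_conj]
  simp
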